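/- arXiv:2604.18989 — 2 statements merged into one kernel-verified Lean document; each statement's English description precedes it below -/
import Mathlib

section
/- (Smallness of the difference of Schur complements on consecutive a-adic scales.) Fix d ≥ 1, an integer a ≥ 5, 0 < β ≤ 1, and a hierarchical potential V_hi with barrier height h. Assume h is large enough (depending only on d and a) that (2d/(h−2d−2))^{2a−0.2} ≤ (4d+h+1)^{−(2a−0.3)}. Let Λ′_k be the 2d_k-neighborhood of Λ_k, L₀ = diam(Λ′_k), and L_j = a^j L₀; for j ≥ 0 put B_j = Λ′_k and let B̄_j be the (aL_j)-neighborhood of B_j, let Γ_j : ℓ²(B_j) → ℓ²(B̄_j∖B_j) be the coupling induced by −Δ, and define the Schur complement S̃^{(j)}_ℰ(B_j) = H_{B_j} − Γ_jᵀ (H_{B̄_j∖B_j} − ℰ)^{−1} Γ_j. Then for all sufficiently large k (depending only on d, h, β, α, d₀, a), every ℰ ∈ [−ι, 4d+β+ι] and every j ≥ 1 with L_j ≤ d_k^{√α}: ‖ S̃^{(j)}_ℰ(B_j) − S̃^{(j−1)}_ℰ(B_{j−1}) ‖ ≤ γ^{(2a−0.3)L_{j−1}}, where γ = 1/(4d+h+β).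 -/
noncomputable section

open scoped ENNReal

namespace HierABM

/-- Sites of the lattice `ℤ^d`. -/
abbrev Site (d : ℕ) := Fin d → ℤ

variable {d : ℕ}

/-- The `ℓ∞`-norm of a lattice site (as a natural number). -/
def linf (x : Site d) : ℕ := Finset.univ.sup fun i => (x i).natAbs

/-- The `ℓ∞`-distance between two lattice sites (as a natural number). -/
def linfDist (x y : Site d) : ℕ := Finset.univ.sup fun i => (x i - y i).natAbs

/-- The `ℓ¹`-distance between two lattice sites; `x ∼ y` means `l1dist x y = 1`. -/
def l1dist (x y : Site d) : ℤ := ∑ i, |x i - y i|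

/-- The `i`-th standard basis vector of `ℤ^d`. -/
def unit (i : Fin d) : Site d := fun j => if j = i then 1 else 0

/-- The discrete Laplacian `Δf(x) = ∑_{y ∼ x} f(y)`. -/
def discLap (f : Site d → ℝ) (x : Site d) : ℝ :=
  ∑ i : Fin d, (f (x + unit i) + f (x - unit i))

/-- The pointwise action of `H(ω) = 2d - Δ + V_hi + β ω`. -/
def hamAct (Vhi : Site d → ℝ) (β : ℝ) (ω : Site d → Bool)
    (f : Site d → ℝ) (x : Site d) : ℝ :=
  (2 * d + Vhi x + β * (if ω x then 1 else 0)) * f x - discLap f x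

/-- The Newtonian scales `d_k = d₀^(α^k)`, i.e. `d_{k+1} = d_k^α`. -/
def nscale (d₀ α : ℝ) (k : ℕ) : ℝ := d₀ ^ (α ^ k)

/-- The block `Λ_k(j) = {x : |x - j|_∞ ≤ 2⌊3 d_k⌋}`. -/
def LambdaS (d₀ α : ℝ) (k : ℕ) (j : Site d) : Set (Site d) :=
  {x | (linfDist x j : ℤ) ≤ 2 * ⌊3 * nscale d₀ α k⌋}

/-- `diam A ≤ r` in the `ℓ∞`-metric. -/
def diamLE (A : Set (Site d)) (r : ℤ) : Prop :=
  ∀ a ∈ A, ∀ b ∈ A, (linfDist a b : ℤ) ≤ r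

/-- `dist(A, B) ≥ r` in the `ℓ∞`-metric. -/
def setDistGE (A B : Set (Site d)) (r : ℝ) : Prop :=
  ∀ a ∈ A, ∀ b ∈ B, r ≤ (linfDist a b : ℝ)

/-- The potential with zero set `W` is `(k, N)`-hierarchical in `Λ_k(j)`. -/
def IsHierIn (d₀ α : ℝ) (N : ℕ) (W : Set (Site d)) : ℕ → Site d → Prop
  | 0, _ => True
  | 1, j => ∃ (m : ℕ) (C : Fin (m + 1) → Set (Site d)),
      m + 1 ≤ N ∧
      W ∩ LambdaS d₀ α 1 j = ⋃ s, C s ∧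
      (∀ s, diamLE (C s) (4 * ⌊3 * d₀⌋)) ∧
      C 0 ⊆ LambdaS d₀ α 0 j ∧
      (∀ s t, s ≠ t → setDistGE (C s) (C t) (2 * nscale d₀ α 1))
  | (k + 2), j => ∃ (m : ℕ) (C : Fin (m + 1) → Set (Site d)),
      m + 1 ≤ N ∧
      W ∩ LambdaS d₀ α (k + 2) j = ⋃ s, C s ∧
      C 0 ⊆ LambdaS d₀ α (k + 1) j ∧
      (∀ s t, s ≠ t → setDistGE (C s) (C t) (2 * nscale d₀ α (k + 2))) ∧
      IsHierIn d₀ α N W (k + 1) j ∧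
      (∀ s : Fin (m + 1), s ≠ 0 → ∃ js : Site d,
        LambdaS d₀ α (k + 1) js ⊆ LambdaS d₀ α (k + 2) j ∧
        C s ⊆ LambdaS d₀ α (k + 1) js ∧
        IsHierIn d₀ α N W (k + 1) js)

/-- `V_hi` is a hierarchical potential with scales `d₀, α`, well density `N`
and barrier height `h`. -/
def IsHierPot (d₀ α : ℝ) (N : ℕ) (h : ℝ) (Vhi : Site d → ℝ) : Prop :=
  (∀ x, Vhi x = 0 ∨ Vhi x = h) ∧
  ∀ k : ℕ, 1 ≤ k → IsHierIn d₀ α N {x | Vhi x = 0} k 0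

/-- The parameter `ι = min{1/100, (h - 4d - β)/2}`. -/
def iota (d : ℕ) (h β : ℝ) : ℝ := min (1 / 100) ((h - 4 * d - β) / 2)

/-- `ℙ` is the i.i.d. Bernoulli(1/2) product measure on `{0,1}^{ℤ^d}`. -/
def IsBernoulliProduct (d : ℕ) (ℙ : MeasureTheory.Measure (Site d → Bool)) : Prop :=
  ∀ (S : Finset (Site d)) (v : Site d → Bool),
    ℙ {ω | ∀ x ∈ S, ω x = v x} = (1 / 2 : ℝ≥0∞) ^ S.card

/-- The lattice box of (integer) radius `R` about `c`, as a finset. -/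
def boxF {d : ℕ} (c : Site d) (R : ℤ) : Finset (Site d) :=
  Fintype.piFinset fun i => Finset.Icc (c i - R) (c i + R)

/-- The block `Λ_k(j)` as a finset. -/
def LambdaF {d : ℕ} (d₀ α : ℝ) (k : ℕ) (j : Site d) : Finset (Site d) :=
  boxF j (2 * ⌊3 * nscale d₀ α k⌋)

/-- `Λ̄_k(j)`, the `(d_{k+1}/10)`-neighborhood of `Λ_k(j)`, as a finset. -/
def barLambdaF {d : ℕ} (d₀ α : ℝ) (k : ℕ) (j : Site d) : Finset (Site d) :=
  boxF j (2 * ⌊3 * nscale d₀ α k⌋ + ⌊nscale d₀ α (k + 1) / 10⌋)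

/-- The Dirichlet restriction `H_Λ = R_Λ H(ω) R_Λ` of `H(ω) = 2d - Δ + V_hi + βω`,
as a matrix indexed by `Λ`: its entries are `2d + V_hi(x) + βω(x)` on the diagonal and
`-1` between nearest neighbors. -/
def HMat {d : ℕ} (Vhi : Site d → ℝ) (β : ℝ) (ω : Site d → Bool) (Λ : Finset (Site d)) :
    Matrix Λ Λ ℝ := fun x y =>
  (if x = y then 2 * d + Vhi (x : Site d) + β * (if ω (x : Site d) then 1 else 0) else 0)
  - (if l1dist (x : Site d) (y : Site d) = 1 then 1 else 0)
/-- The coupling matrix `Γ : ℓ²(B) → ℓ²(A)` induced by `-Δ`: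
`Γ(y, x) = -1` if `x ∼ y` and `0` otherwise. -/
def coupling {d : ℕ} (B A : Finset (Site d)) : Matrix A B ℝ := fun y x =>
  if l1dist (y : Site d) (x : Site d) = 1 then -1 else 0

/-- The Schur complement `S_ℰ = H_B - Γᵀ (H_{B̄∖B} - ℰ)⁻¹ Γ` of `H_{B̄}` with respect
to the block `B`, at energy `ℰ`. -/
def schurC {d : ℕ} (Vhi : Site d → ℝ) (β : ℝ) (ω : Site d → Bool)
    (B Bbar : Finset (Site d)) (ℰ : ℝ) : Matrix B B ℝ :=
  HMat Vhi β ω B -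
    (coupling B (Bbar \ B)).transpose *
      (HMat Vhi β ω (Bbar \ B) - ℰ • (1 : Matrix ↥(Bbar \ B) ↥(Bbar \ B) ℝ))⁻¹ *
      coupling B (Bbar \ B)

/-- The Euclidean (`ℓ²`) norm of a finitely supported vector. -/
def l2norm {ι : Type*} [Fintype ι] (v : ι → ℝ) : ℝ := Real.sqrt (∑ i, v i ^ 2)

/-- The radius of `Λ'_k`, the `2d_k`-neighborhood of `Λ_k`. -/
def LpRad (d₀ α : ℝ) (k : ℕ) : ℤ := 2 * ⌊3 * nscale d₀ α k⌋ + ⌊2 * nscale d₀ α k⌋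

/-- `Λ'_k`, the `2d_k`-neighborhood of `Λ_k = Λ_k(0)`, which serves as the block
`B_j` at every `a`-adic step `j`. -/
def smallB (d : ℕ) (d₀ α : ℝ) (k : ℕ) : Finset (Site d) :=
  boxF (0 : Site d) (LpRad d₀ α k)

/-- `B̄_j`, the `aL_j`-neighborhood of `B_j = Λ'_k`, where `L_j = a^j L₀` and
`L₀ = diam Λ'_k`. -/
def bigB (d : ℕ) (d₀ α : ℝ) (a k j : ℕ) : Finset (Site d) :=
  boxF (0 : Site d) (LpRad d₀ α k + (a : ℤ) ^ (j + 1) * (2 * LpRad d₀ α k))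

lemma linf_le_iff {x : Site d} {n : ℕ} : linf x ≤ n ↔ ∀ i, (x i).natAbs ≤ n := by
  simp [linf, Finset.sup_le_iff]

lemma mem_boxF_zero_iff {x : Site d} {n : ℕ} : x ∈ boxF (0 : Site d) n ↔ linf x ≤ n := by
  rw [linf_le_iff, boxF, Fintype.mem_piFinset]
  refine forall_congr' fun i => ?_
  simp only [Pi.zero_apply, Finset.mem_Icc]
  omega

lemma l1dist_comm (x y : Site d) : l1dist x y = l1dist y x :=
  Finset.sum_congr rfl fun i _ => abs_sub_comm (x i) (y i)

lemma linf_le_add_one {x y : Site d} (hxy : l1dist x y = 1) : linf x ≤ linf y + 1 := by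
  rw [linf_le_iff]
  intro i
  have h1 : (y i).natAbs ≤ linf y := linf_le_iff.1 le_rfl i
  have h2 : |x i - y i| ≤ l1dist x y :=
    Finset.single_le_sum (f := fun i => |x i - y i|) (fun _ _ => abs_nonneg _)
      (Finset.mem_univ i)
  rw [hxy, abs_le] at h2
  omega

lemma eq_add_or_sub_unit {x y : Site d} (hxy : l1dist x y = 1) :
    ∃ i, y = x + unit i ∨ y = x - unit i := by
  obtain ⟨i, hi⟩ : ∃ i, x i ≠ y i := by
    by_contra! hall
    simp [l1dist, hall] at hxy
  have hi1 : 1 ≤ |x i - y i| := Int.one_le_abs (sub_ne_zero.2 hi)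
  have hsplit := Finset.add_sum_erase Finset.univ (fun i => |x i - y i|) (Finset.mem_univ i)
  have hrest : 0 ≤ ∑ l ∈ Finset.univ.erase i, |x l - y l| :=
    Finset.sum_nonneg fun _ _ => abs_nonneg _
  simp only [l1dist] at hxy
  have hzero : ∑ l ∈ Finset.univ.erase i, |x l - y l| = 0 := by omega
  have hi2 : |x i - y i| = 1 := by omega
  have hother : ∀ l, l ≠ i → x l = y l := fun l hl => by
    have := (Finset.sum_eq_zero_iff_of_nonneg fun _ _ => abs_nonneg _).1 hzero l
      (Finset.mem_erase.2 ⟨hl, Finset.mem_univ l⟩)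
    exact sub_eq_zero.1 (abs_eq_zero.1 this)
  refine ⟨i, ?_⟩
  rcases (abs_eq zero_le_one).1 hi2 with hs | hs
  · right
    funext l
    by_cases hl : l = i
    · subst hl; simp [unit]; omega
    · simp [unit, hl, hother l hl]
  · left
    funext l
    by_cases hl : l = i
    · subst hl; simp [unit]; omega
    · simp [unit, hl, hother l hl]

/-- The sum of `u` over the nearest neighbors of `x` lying in `T`. -/
def nbrSum (T : Finset (Site d)) (u : Site d → ℝ) (x : Site d) : ℝ :=
  ∑ y ∈ T, if l1dist x y = 1 then u y else 0

lemma card_filter_l1dist_le (T : Finset (Site d)) (x : Site d) :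
    (T.filter fun y => l1dist x y = 1).card ≤ 2 * d := by
  classical
  have hsub : (T.filter fun y => l1dist x y = 1) ⊆
      (Finset.univ.image fun i : Fin d => x + unit i) ∪
        Finset.univ.image fun i : Fin d => x - unit i := by
    intro y hy
    obtain ⟨i, hi | hi⟩ := eq_add_or_sub_unit (Finset.mem_filter.1 hy).2
    · exact Finset.mem_union_left _ (Finset.mem_image.2 ⟨i, Finset.mem_univ i, hi.symm⟩)
    · exact Finset.mem_union_right _ (Finset.mem_image.2 ⟨i, Finset.mem_univ i, hi.symm⟩)
  refine (Finset.card_le_card hsub).trans ((Finset.card_union_le _ _).trans ?_)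
  have h1 := Finset.card_image_le (s := Finset.univ) (f := fun i : Fin d => x + unit i)
  have h2 := Finset.card_image_le (s := Finset.univ) (f := fun i : Fin d => x - unit i)
  rw [Finset.card_univ, Fintype.card_fin] at h1 h2
  omega

lemma abs_nbrSum_le (T : Finset (Site d)) (u : Site d → ℝ) (x : Site d) {M : ℝ} (hM : 0 ≤ M)
    (hu : ∀ y, l1dist x y = 1 → |u y| ≤ M) : |nbrSum T u x| ≤ 2 * d * M := by
  rw [nbrSum, ← Finset.sum_filter]
  calc |∑ y ∈ T with l1dist x y = 1, u y|
      ≤ ∑ y ∈ T with l1dist x y = 1, |u y| := Finset.abs_sum_le_sum_abs _ _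
    _ ≤ (T.filter fun y => l1dist x y = 1).card • M :=
        Finset.sum_le_card_nsmul _ _ _ fun y hy => hu y (Finset.mem_filter.1 hy).2
    _ ≤ 2 * d * M := by
        rw [nsmul_eq_mul]
        have : ((T.filter fun y => l1dist x y = 1).card : ℝ) ≤ 2 * d := by
          exact_mod_cast card_filter_l1dist_le T x
        gcongr

lemma nbrSum_sub (T : Finset (Site d)) (u v : Site d → ℝ) (x : Site d) :
    nbrSum T (u - v) x = nbrSum T u x - nbrSum T v x := by
  simp only [nbrSum, ← Finset.sum_sub_distrib]
  refine Finset.sum_congr rfl fun y _ => ?_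
  split_ifs <;> simp

lemma nbrSum_eq_of_subset {T T' : Finset (Site d)} (hT : T ⊆ T') {u : Site d → ℝ}
    (hu : ∀ y ∉ T, u y = 0) (x : Site d) : nbrSum T u x = nbrSum T' u x :=
  Finset.sum_subset hT fun y _ hy => by simp [hu y hy]

/-- Maximum principle with decay: a solution of `D u = ∑_{y ∼ x, y ∈ T} u(y)` on the finite
set `S` with `2d ≤ r D`, `r < 1`, inherits the bound `M r ^ φ` from the complement of `S`
whenever `φ` increases by at most one between nearest neighbors. -/
lemma abs_le_mul_pow_of_eq_nbrSum (hd : 1 ≤ d) {S T : Finset (Site d)} {D u : Site d → ℝ}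
    {r M : ℝ} (hr0 : 0 < r) (hr1 : r < 1) (hM : 0 ≤ M) (hD : ∀ x ∈ S, 2 * (d : ℝ) ≤ r * D x)
    (heq : ∀ x ∈ S, D x * u x = nbrSum T u x) {φ : Site d → ℕ}
    (hφ : ∀ x y, l1dist x y = 1 → φ x ≤ φ y + 1)
    (hout : ∀ x ∉ S, |u x| ≤ M * r ^ φ x) (x : Site d) : |u x| ≤ M * r ^ φ x := by
  have hd' : (1 : ℝ) ≤ d := by exact_mod_cast hd
  have hDpos : ∀ x ∈ S, 0 < D x := fun x hx =>
    pos_of_mul_pos_right (by linarith [hD x hx] : 0 < r * D x) hr0.le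
  have step : ∀ x ∈ S, ∀ M', 0 ≤ M' → (∀ y, l1dist x y = 1 → |u y| ≤ M') →
      |u x| ≤ r * M' := by
    intro x hx M' hM' hy
    have h1 := abs_nbrSum_le T u x hM' hy
    rw [← heq x hx, abs_mul, abs_of_pos (hDpos x hx)] at h1
    have h2 := mul_le_mul_of_nonneg_right (hD x hx) hM'
    exact le_of_mul_le_mul_left (by linarith : D x * |u x| ≤ D x * (r * M')) (hDpos x hx)
  have hout' : ∀ x ∉ S, |u x| ≤ M := fun x hx =>
    (hout x hx).trans (mul_le_of_le_one_right hM (pow_le_one₀ hr0.le hr1.le))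
  have hbdd : ∀ x, |u x| ≤ M := by
    intro x
    by_cases hx : x ∈ S
    swap
    · exact hout' x hx
    obtain ⟨z, hz, hmax⟩ := S.exists_max_image (fun x => |u x|) ⟨x, hx⟩
    refine (hmax x hx).trans ?_
    by_contra! hlt
    have hall : ∀ y, |u y| ≤ |u z| := fun y => by
      by_cases hy : y ∈ S
      · exact hmax y hy
      · exact (hout' y hy).trans hlt.le
    have := step z hz _ (abs_nonneg _) fun y _ => hall y
    nlinarith
  have hind : ∀ n : ℕ, ∀ x, |u x| ≤ M * r ^ min n (φ x) := by
    intro n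
    induction n with
    | zero => simpa using hbdd
    | succ n ih =>
      intro x
      by_cases hx : x ∈ S
      swap
      · exact (hout x hx).trans (mul_le_mul_of_nonneg_left
          (pow_le_pow_of_le_one hr0.le hr1.le (min_le_right _ _)) hM)
      rcases Nat.eq_zero_or_pos (φ x) with h0 | hpos
      · simpa [h0] using hbdd x
      have := step x hx (M * r ^ (min (n + 1) (φ x) - 1)) (by positivity) fun y hy =>
        (ih y).trans (mul_le_mul_of_nonneg_left
          (pow_le_pow_of_le_one hr0.le hr1.le (by have := hφ x y hy; omega)) hM)
      refine this.trans_eq ?_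
      rw [mul_left_comm, ← pow_succ']
      congr 2
      omega
  simpa using hind (φ x) x

/-- Extension by zero of a function on a finite set of sites. -/
def extZero {A : Finset (Site d)} (f : A → ℝ) (x : Site d) : ℝ :=
  if hx : x ∈ A then f ⟨x, hx⟩ else 0

lemma extZero_coe {A : Finset (Site d)} (f : A → ℝ) (x : A) : extZero f x = f x := by
  simp [extZero]

lemma extZero_of_notMem {A : Finset (Site d)} (f : A → ℝ) {x : Site d} (hx : x ∉ A) :
    extZero f x = 0 := by
  simp [extZero, hx]

lemma sum_ite_eq_nbrSum {A : Finset (Site d)} (f : A → ℝ) (x : Site d) :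
    ∑ y : A, (if l1dist x y = 1 then f y else 0) = nbrSum A (extZero f) x := by
  rw [nbrSum, ← Finset.sum_coe_sort A]
  simp only [extZero_coe]

/-- The diagonal of `H(ω) - ℰ`. -/
def diagShift (Vhi : Site d → ℝ) (β : ℝ) (ω : Site d → Bool) (ℰ : ℝ) (x : Site d) : ℝ :=
  2 * d + Vhi x + β * (if ω x then 1 else 0) - ℰ

lemma HMat_sub_smul_mulVec (Vhi : Site d → ℝ) (β : ℝ) (ω : Site d → Bool) (ℰ : ℝ)
    {A : Finset (Site d)} (f : A → ℝ) (x : A) :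
    ((HMat Vhi β ω A - ℰ • (1 : Matrix A A ℝ)).mulVec f) x =
      diagShift Vhi β ω ℰ x * f x - nbrSum A (extZero f) x := by
  rw [← sum_ite_eq_nbrSum, Matrix.mulVec, dotProduct]
  have hterm : ∀ y : A, (HMat Vhi β ω A - ℰ • (1 : Matrix A A ℝ)) x y * f y =
      (if x = y then diagShift Vhi β ω ℰ x * f y else 0) -
        (if l1dist (x : Site d) y = 1 then f y else 0) := by
    intro y
    simp only [Matrix.sub_apply, Matrix.smul_apply, Matrix.one_apply, HMat, diagShift,
      smul_eq_mul]
    by_cases hxy : x = y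
    · subst hxy
      simp [l1dist]
    · by_cases h1 : l1dist (x : Site d) (y : Site d) = 1 <;> simp [hxy, h1]
  rw [Finset.sum_congr rfl fun y _ => hterm y, Finset.sum_sub_distrib]
  simp

lemma coupling_mulVec {B A : Finset (Site d)} (e : B → ℝ) (x : A) :
    ((coupling B A).mulVec e) x = -nbrSum B (extZero e) x := by
  rw [← sum_ite_eq_nbrSum, Matrix.mulVec, dotProduct, ← Finset.sum_neg_distrib]
  refine Finset.sum_congr rfl fun y _ => ?_
  simp only [coupling]
  split_ifs <;> simp

lemma coupling_transpose (B A : Finset (Site d)) : (coupling B A).transpose = coupling A B := by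
  ext x y
  simp [coupling, l1dist_comm]

lemma HMat_transpose (Vhi : Site d → ℝ) (β : ℝ) (ω : Site d → Bool) (A : Finset (Site d)) :
    (HMat Vhi β ω A).transpose = HMat Vhi β ω A := by
  ext x y
  simp only [Matrix.transpose_apply, HMat, l1dist_comm (y : Site d) x, eq_comm (a := y)]
  by_cases hxy : x = y <;> simp [hxy]

lemma schurC_transpose (Vhi : Site d → ℝ) (β : ℝ) (ω : Site d → Bool)
    (B Bbar : Finset (Site d)) (ℰ : ℝ) :
    (schurC Vhi β ω B Bbar ℰ).transpose = schurC Vhi β ω B Bbar ℰ := by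
  simp only [schurC, Matrix.transpose_sub, Matrix.transpose_mul, Matrix.transpose_transpose,
    Matrix.transpose_nonsing_inv, HMat_transpose, Matrix.transpose_smul, Matrix.transpose_one,
    Matrix.mul_assoc]

/-- Schur test for a symmetric matrix that is bounded by `C` on the `ℓ∞` unit ball. -/
lemma l2norm_mulVec_le_of_forall_abs_le {n : Type*} [Fintype n] {M : Matrix n n ℝ}
    (hM : M.transpose = M) {C : ℝ} (hC : 0 ≤ C)
    (hbound : ∀ e : n → ℝ, (∀ y, |e y| ≤ 1) → ∀ x, |M.mulVec e x| ≤ C) (v : n → ℝ) :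
    l2norm (M.mulVec v) ≤ C * l2norm v := by
  have hrow : ∀ x, ∑ y, |M x y| ≤ C := by
    intro x
    have h1 := hbound (fun y => SignType.sign (M x y))
      (fun y => by rcases lt_trichotomy (M x y) 0 with h | h | h <;> simp [h]) x
    refine le_trans ?_ ((le_abs_self _).trans h1)
    rw [Matrix.mulVec, dotProduct]
    exact Finset.sum_le_sum fun y _ => (self_mul_sign (M x y)).ge
  have hcol : ∀ y, ∑ x, |M x y| ≤ C := by
    intro y
    have : ∀ x, M x y = M y x := fun x => by rw [← Matrix.transpose_apply M y x, hM]
    simpa only [this] using hrow y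
  have hsq : ∀ x, M.mulVec v x ^ 2 ≤ C * ∑ y, |M x y| * v y ^ 2 := by
    intro x
    have hcs := Finset.sum_sq_le_sum_mul_sum_of_sq_le_mul Finset.univ
      (r := fun y => M x y * v y) (f := fun y => |M x y|) (g := fun y => |M x y| * v y ^ 2)
      (fun _ _ => abs_nonneg _) (fun _ _ => by positivity)
      (fun y _ => by
        have := abs_mul_abs_self (M x y)
        nlinarith)
    exact hcs.trans (mul_le_mul_of_nonneg_right (hrow x)
      (Finset.sum_nonneg fun _ _ => by positivity))
  have htotal : ∑ x, M.mulVec v x ^ 2 ≤ C ^ 2 * ∑ y, v y ^ 2 := by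
    calc ∑ x, M.mulVec v x ^ 2 ≤ ∑ x, C * ∑ y, |M x y| * v y ^ 2 :=
          Finset.sum_le_sum fun x _ => hsq x
      _ = C * ∑ y, (∑ x, |M x y|) * v y ^ 2 := by
          rw [← Finset.mul_sum, Finset.sum_comm]
          simp only [Finset.sum_mul]
      _ ≤ C * ∑ y, C * v y ^ 2 := by
          gcongr with y
          exact hcol y
      _ = C ^ 2 * ∑ y, v y ^ 2 := by rw [← Finset.mul_sum]; ring
  rw [l2norm, l2norm]
  calc √(∑ x, M.mulVec v x ^ 2) ≤ √(C ^ 2 * ∑ y, v y ^ 2) := Real.sqrt_le_sqrt htotal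
    _ = C * √(∑ y, v y ^ 2) := by rw [Real.sqrt_mul (sq_nonneg C), Real.sqrt_sq hC]

lemma isUnit_HMat_sub_smul (hd : 1 ≤ d) {Vhi : Site d → ℝ} {β : ℝ} {ω : Site d → Bool} {ℰ : ℝ}
    {A : Finset (Site d)} {r : ℝ} (hr0 : 0 < r) (hr1 : r < 1)
    (hD : ∀ x ∈ A, 2 * (d : ℝ) ≤ r * diagShift Vhi β ω ℰ x) :
    IsUnit (HMat Vhi β ω A - ℰ • (1 : Matrix A A ℝ)) := by
  rw [← Matrix.mulVec_injective_iff_isUnit]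
  refine (injective_iff_map_eq_zero
    (HMat Vhi β ω A - ℰ • (1 : Matrix A A ℝ)).mulVecLin).2 fun f hf => ?_
  have heq : ∀ x ∈ A, diagShift Vhi β ω ℰ x * extZero f x = nbrSum A (extZero f) x := by
    intro x hx
    have h1 := congrFun hf ⟨x, hx⟩
    rw [Matrix.mulVecLin_apply, HMat_sub_smul_mulVec] at h1
    rw [extZero_coe f ⟨x, hx⟩]
    exact sub_eq_zero.1 h1
  funext x
  have := abs_le_mul_pow_of_eq_nbrSum hd hr0 hr1 le_rfl hD heq (φ := fun _ => 0)
    (fun _ _ _ => by simp) (fun x hx => by simp [extZero_of_notMem f hx]) x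
  simpa [extZero_coe] using this

/-- The solution `f = (H_A - ℰ)⁻¹ Γ e` of the exterior problem with data `e` on `B`. -/
def exteriorSol (Vhi : Site d → ℝ) (β : ℝ) (ω : Site d → Bool) (ℰ : ℝ) {B : Finset (Site d)}
    (A : Finset (Site d)) (e : B → ℝ) : A → ℝ :=
  (HMat Vhi β ω A - ℰ • (1 : Matrix A A ℝ))⁻¹.mulVec ((coupling B A).mulVec e)

lemma exteriorSol_spec (hd : 1 ≤ d) {Vhi : Site d → ℝ} {β : ℝ} {ω : Site d → Bool} {ℰ : ℝ}
    {A B : Finset (Site d)} {r : ℝ} (hr0 : 0 < r) (hr1 : r < 1)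
    (hD : ∀ x ∈ A, 2 * (d : ℝ) ≤ r * diagShift Vhi β ω ℰ x) (e : B → ℝ) {x : Site d}
    (hx : x ∈ A) :
    diagShift Vhi β ω ℰ x * extZero (exteriorSol Vhi β ω ℰ A e) x =
      nbrSum A (extZero (exteriorSol Vhi β ω ℰ A e)) x - nbrSum B (extZero e) x := by
  have hunit := (Matrix.isUnit_iff_isUnit_det _).1 (isUnit_HMat_sub_smul hd hr0 hr1 hD)
  have hsol : (HMat Vhi β ω A - ℰ • (1 : Matrix A A ℝ)).mulVec (exteriorSol Vhi β ω ℰ A e) =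
      (coupling B A).mulVec e := by
    rw [exteriorSol, Matrix.mulVec_mulVec, Matrix.mul_nonsing_inv _ hunit, Matrix.one_mulVec]
  have h1 := congrFun hsol ⟨x, hx⟩
  rw [HMat_sub_smul_mulVec, coupling_mulVec] at h1
  rw [extZero_coe _ ⟨x, hx⟩]
  linarith

lemma schurC_mulVec (Vhi : Site d → ℝ) (β : ℝ) (ω : Site d → Bool)
    (B Bbar : Finset (Site d)) (ℰ : ℝ) (e : B → ℝ) (b : B) :
    (schurC Vhi β ω B Bbar ℰ).mulVec e b = (HMat Vhi β ω B).mulVec e b +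
      nbrSum (Bbar \ B) (extZero (exteriorSol Vhi β ω ℰ (Bbar \ B) e)) b := by
  rw [schurC, Matrix.sub_mulVec, ← Matrix.mulVec_mulVec, ← Matrix.mulVec_mulVec,
    coupling_transpose, Pi.sub_apply, coupling_mulVec, exteriorSol, sub_neg_eq_add]

lemma abs_exteriorSol_le (hd : 1 ≤ d) {Vhi : Site d → ℝ} {β : ℝ} {ω : Site d → Bool} {ℰ : ℝ}
    {A B : Finset (Site d)} (hAB : Disjoint A B) {R : ℕ} (hB : ∀ x, x ∈ B ↔ linf x ≤ R)
    {r : ℝ} (hr0 : 0 < r) (hr1 : r < 1)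
    (hD : ∀ x ∈ A, 2 * (d : ℝ) ≤ r * diagShift Vhi β ω ℰ x)
    {e : B → ℝ} (he : ∀ y, |e y| ≤ 1) {x : Site d} (hx : R < linf x) :
    |extZero (exteriorSol Vhi β ω ℰ A e) x| ≤ r ^ (linf x - R) := by
  set f := extZero (exteriorSol Vhi β ω ℰ A e) with hf
  have hfB : ∀ y ∈ B, f y = 0 := fun y hy =>
    extZero_of_notMem _ (Finset.disjoint_right.1 hAB hy)
  have heq : ∀ x ∈ A, diagShift Vhi β ω ℰ x * (f - extZero e) x =
      nbrSum (A ∪ B) (f - extZero e) x := by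
    intro x hx
    rw [nbrSum_sub, ← nbrSum_eq_of_subset Finset.subset_union_left
        (fun y hy => extZero_of_notMem _ hy),
      ← nbrSum_eq_of_subset Finset.subset_union_right (fun y hy => extZero_of_notMem _ hy),
      ← exteriorSol_spec hd hr0 hr1 hD e hx, Pi.sub_apply,
      extZero_of_notMem e (Finset.disjoint_left.1 hAB hx), sub_zero]
  have hxB : x ∉ B := fun h => absurd ((hB x).1 h) (by omega)
  have := abs_le_mul_pow_of_eq_nbrSum hd hr0 hr1 zero_le_one hD heq
    (φ := fun x => linf x - R)
    (fun x y hxy => by have := linf_le_add_one hxy; omega)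
    (fun y hy => by
      by_cases hyB : y ∈ B
      · have h1 : linf y - R = 0 := Nat.sub_eq_zero_of_le ((hB y).1 hyB)
        rw [Pi.sub_apply, hfB y hyB, extZero_coe e ⟨y, hyB⟩, h1]
        simpa using he ⟨y, hyB⟩
      · rw [Pi.sub_apply, extZero_of_notMem e hyB, hf, extZero_of_notMem _ hy]
        simp only [sub_zero, abs_zero, one_mul]
        positivity) x
  rwa [Pi.sub_apply, extZero_of_notMem e hxB, sub_zero, one_mul] at this

/-- Enlarging the outer box beyond distance `m` from the inner one changes the action of the
Schur complement on the `ℓ∞` unit ball by at most `2d r ^ (2m)`. -/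
lemma abs_schurC_sub_mulVec_le (hd : 1 ≤ d) {Vhi : Site d → ℝ} {β : ℝ} {ω : Site d → Bool}
    {ℰ : ℝ} {B B' Bbar : Finset (Site d)} {R m : ℕ} (hB : ∀ x, x ∈ B ↔ linf x ≤ R)
    (hB' : ∀ x, x ∈ B' ↔ linf x ≤ R + m) (hB'Bbar : B' ⊆ Bbar) {r : ℝ} (hr0 : 0 < r)
    (hr1 : r < 1) (hD : ∀ x ∈ Bbar \ B, 2 * (d : ℝ) ≤ r * diagShift Vhi β ω ℰ x)
    {e : B → ℝ} (he : ∀ y, |e y| ≤ 1) (b : B) :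
    |(schurC Vhi β ω B Bbar ℰ - schurC Vhi β ω B B' ℰ).mulVec e b| ≤ 2 * d * r ^ (2 * m) := by
  rw [Matrix.sub_mulVec, Pi.sub_apply, schurC_mulVec, schurC_mulVec, add_sub_add_left_eq_sub]
  have hAB : Disjoint (Bbar \ B) B := Finset.sdiff_disjoint
  have hsub : B' \ B ⊆ Bbar \ B := Finset.sdiff_subset_sdiff hB'Bbar le_rfl
  have hA' : ∀ y ∉ B, linf y ≤ R + m → y ∈ B' \ B := fun y hy hle =>
    Finset.mem_sdiff.2 ⟨(hB' y).2 hle, hy⟩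
  generalize Bbar \ B = A at *
  generalize B' \ B = A' at *
  have hD' : ∀ x ∈ A', 2 * (d : ℝ) ≤ r * diagShift Vhi β ω ℰ x := fun x hx => hD x (hsub hx)
  set f := extZero (exteriorSol Vhi β ω ℰ A e) with hf
  set g := extZero (exteriorSol Vhi β ω ℰ A' e)
  have hg0 : ∀ y ∉ A', g y = 0 := fun y hy => extZero_of_notMem _ hy
  have heq : ∀ x ∈ A', diagShift Vhi β ω ℰ x * (f - g) x = nbrSum A (f - g) x := by
    intro x hx
    rw [nbrSum_sub, ← nbrSum_eq_of_subset hsub hg0, Pi.sub_apply, mul_sub,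
      exteriorSol_spec hd hr0 hr1 hD e (hsub hx), exteriorSol_spec hd hr0 hr1 hD' e hx]
    ring
  have hdecay := abs_le_mul_pow_of_eq_nbrSum hd hr0 hr1 (pow_nonneg hr0.le (m + 1)) hD' heq
    (φ := fun x => R + m + 1 - linf x)
    (fun x y hxy => by
      have := linf_le_add_one ((l1dist_comm y x).trans hxy); omega)
    (fun y hy => by
      rw [Pi.sub_apply, hg0 y hy, sub_zero]
      by_cases hyB : y ∈ B
      · rw [hf, extZero_of_notMem _ (Finset.disjoint_right.1 hAB hyB), abs_zero]
        positivity
      · have h1 : R + m + 1 ≤ linf y := by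
          by_contra! hlt
          exact hy (hA' y hyB (by omega))
        rw [Nat.sub_eq_zero_of_le h1, pow_zero, mul_one]
        exact (abs_exteriorSol_le hd hAB hB hr0 hr1 hD he (by omega)).trans
          (pow_le_pow_of_le_one hr0.le hr1.le (by omega)))
  have hb : linf (b : Site d) ≤ R := (hB b).1 b.2
  rw [nbrSum_eq_of_subset hsub hg0, ← nbrSum_sub]
  refine abs_nbrSum_le _ _ _ (by positivity) fun y hy => (hdecay y).trans ?_
  rw [← pow_add]
  have := linf_le_add_one ((l1dist_comm y b).trans hy)
  exact pow_le_pow_of_le_one hr0.le hr1.le (by omega)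

lemma tendsto_LpRad {d₀ α : ℝ} (hd₀ : 1 < d₀) (hα : 1 < α) :
    Filter.Tendsto (fun k => (LpRad d₀ α k : ℝ)) Filter.atTop Filter.atTop := by
  have hn : Filter.Tendsto (nscale d₀ α) Filter.atTop Filter.atTop :=
    (tendsto_rpow_atTop_of_base_gt_one d₀ hd₀).comp (tendsto_pow_atTop_atTop_of_one_lt hα)
  refine Filter.tendsto_atTop_mono (fun k => ?_) hn
  have h0 : 0 ≤ nscale d₀ α k := Real.rpow_nonneg (by linarith) _
  have h1 : (1 : ℝ) ≤ nscale d₀ α k := Real.one_le_rpow hd₀.le (by positivity)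
  have h2 : (0 : ℝ) ≤ ⌊3 * nscale d₀ α k⌋ := by
    exact_mod_cast Int.floor_nonneg.2 (by positivity)
  have h3 := Int.lt_floor_add_one (2 * nscale d₀ α k)
  simp only [LpRad]
  push_cast
  linarith

lemma two_mul_pow_le_rpow {q c C γ p L : ℝ} {m : ℕ} (hq0 : 0 < q)
    (hC : 0 < C) (hγ : C⁻¹ ≤ γ) (hL : 0 ≤ L) (hp : 0.3 ≤ p)
    (hqC : q ^ (p - 0.2) ≤ C ^ (-(p - 0.3))) (hm : ((2 * m : ℕ) : ℝ) = p * L)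
    (hsmall : c * q ^ (0.2 * L) ≤ 1) : c * q ^ (2 * m) ≤ γ ^ ((p - 0.3) * L) := by
  have hsplit : q ^ (2 * m) = q ^ (0.2 * L) * (q ^ (p - 0.2)) ^ L := by
    rw [← Real.rpow_natCast, hm, ← Real.rpow_mul hq0.le, ← Real.rpow_add hq0]
    congr 1
    ring
  calc c * q ^ (2 * m) = c * q ^ (0.2 * L) * (q ^ (p - 0.2)) ^ L := by rw [hsplit]; ring
    _ ≤ 1 * (C ^ (-(p - 0.3))) ^ L := by gcongr
    _ = C⁻¹ ^ ((p - 0.3) * L) := by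
        rw [one_mul, ← Real.rpow_mul hC.le, Real.inv_rpow hC.le, ← Real.rpow_neg hC.le]
        congr 1
        ring
    _ ≤ γ ^ ((p - 0.3) * L) := by
        have : 0 ≤ (p - 0.3) * L := mul_nonneg (by linarith) hL
        gcongr

/-- **Smallness of the difference of Schur complements on consecutive `a`-adic
scales** (Claim 4.4).

With `B_j = Λ'_k`, `L₀ = diam Λ'_k`, `L_j = a^j L₀` and `B̄_j` the `aL_j`-neighborhood
of `B_j`, and with the annulus `B̄_j ∖ B_j` lying in the barrier, for all sufficiently
large `k`, every `1 ≤ j` with `L_j ≤ d_k^{√α}` and every `ℰ ∈ [-ι, 4d+β+ι]`, the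
Schur complements `S̃⁽ʲ⁾_ℰ = H_{B_j} - Γ_jᵀ (H_{B̄_j∖B_j} - ℰ)⁻¹ Γ_j` satisfy
`‖S̃⁽ʲ⁾_ℰ - S̃⁽ʲ⁻¹⁾_ℰ‖ ≤ γ^{(2a-0.3)L_{j-1}}` in the `ℓ² → ℓ²` operator norm,
where `γ = 1/(4d+h+β)`. -/
theorem schur_scale_difference
    (d : ℕ) (hd : 1 ≤ d) (a : ℕ) (ha : 5 ≤ a)
    (d₀ α : ℝ) (hd₀ : 1 < d₀) (hα : 1 < α)
    (N : ℕ) (hN : 1 ≤ N)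
    (h β : ℝ) (hh : 4 * (d : ℝ) + 1 < h) (hβ0 : 0 < β) (hβ1 : β ≤ 1)
    (hhbig : (2 * (d : ℝ) / (h - 2 * d - 2)) ^ ((2 * (a : ℝ) - 0.2)) ≤
      (4 * (d : ℝ) + h + 1) ^ (-(2 * (a : ℝ) - 0.3))) :
    ∃ k₀ : ℕ,
      ∀ Vhi : Site d → ℝ, IsHierPot d₀ α N h Vhi →
      ∀ ω : Site d → Bool,
      ∀ k : ℕ, k₀ ≤ k →
      ∀ j : ℕ, 1 ≤ j →
        (a : ℝ) ^ j * (2 * (LpRad d₀ α k : ℝ)) ≤ nscale d₀ α k ^ Real.sqrt α →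
        (∀ x ∈ bigB d d₀ α a k j \ smallB d d₀ α k, Vhi x = h) →
      ∀ ℰ : ℝ, ℰ ∈ Set.Icc (-(iota d h β)) (4 * (d : ℝ) + β + iota d h β) →
      ∀ v : ↥(smallB d d₀ α k) → ℝ,
        l2norm ((schurC Vhi β ω (smallB d d₀ α k) (bigB d d₀ α a k j) ℰ -
            schurC Vhi β ω (smallB d d₀ α k) (bigB d d₀ α a k (j - 1)) ℰ).mulVec v) ≤
          (1 / (4 * (d : ℝ) + h + β)) ^
              ((2 * (a : ℝ) - 0.3) * ((a : ℝ) ^ (j - 1) * (2 * (LpRad d₀ α k : ℝ)))) *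
            l2norm v := by
  have hd' : (1 : ℝ) ≤ d := by exact_mod_cast hd
  have ha' : (5 : ℝ) ≤ a := by exact_mod_cast ha
  set q : ℝ := 2 * (d : ℝ) / (h - 2 * d - 2) with hq
  have hden : 0 < h - 2 * d - 2 := by linarith
  have hq0 : 0 < q := by positivity
  have hq1 : q < 1 := by
    by_contra! hge
    have h1 : (1 : ℝ) ≤ q ^ (2 * (a : ℝ) - 0.2) := Real.one_le_rpow hge (by linarith)
    have h2 : (4 * (d : ℝ) + h + 1) ^ (-(2 * (a : ℝ) - 0.3)) < 1 :=
      Real.rpow_lt_one_of_one_lt_of_neg (by linarith) (by linarith)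
    linarith
  have hlim : Filter.Tendsto (fun k => 2 * (d : ℝ) * q ^ (0.2 * (LpRad d₀ α k : ℝ)))
      Filter.atTop (nhds (2 * d * 0)) :=
    ((tendsto_rpow_atTop_of_base_lt_one q (by linarith) hq1).comp
      ((tendsto_LpRad hd₀ hα).const_mul_atTop (by norm_num))).const_mul _
  rw [mul_zero] at hlim
  obtain ⟨k₀, hk₀⟩ := Filter.eventually_atTop.1 ((hlim.eventually (gt_mem_nhds one_pos)).and
    ((tendsto_LpRad hd₀ hα).eventually_ge_atTop 0))
  refine ⟨k₀, fun Vhi _ ω k hk j hj _ hV ℰ hℰ v => ?_⟩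
  obtain ⟨hsmall, hR⟩ := hk₀ k hk
  obtain ⟨i, rfl⟩ : ∃ i, j = i + 1 := ⟨j - 1, by omega⟩
  obtain ⟨R, hRn⟩ := Int.eq_ofNat_of_zero_le (by exact_mod_cast hR : 0 ≤ LpRad d₀ α k)
  have hbig : ∀ l, bigB d d₀ α a k l = boxF (0 : Site d) (R + a ^ (l + 1) * (2 * R) : ℕ) := by
    intro l
    rw [bigB, hRn]
    push_cast
    rfl
  have hsmallB : smallB d d₀ α k = boxF (0 : Site d) R := by rw [smallB, hRn]
  rw [hRn, Int.cast_natCast] at hsmall ⊢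
  rw [hbig] at hV
  rw [add_tsub_cancel_right, hbig, hbig]
  revert v
  rw [hsmallB] at hV ⊢
  intro v
  have hD : ∀ x ∈ boxF (0 : Site d) (R + a ^ (i + 1 + 1) * (2 * R) : ℕ) \ boxF (0 : Site d) R,
      2 * (d : ℝ) ≤ q * diagShift Vhi β ω ℰ x := by
    intro x hx
    have hι : iota d h β ≤ 1 / 100 := min_le_left _ _
    have hω : 0 ≤ β * (if ω x then (1 : ℝ) else 0) := by split_ifs <;> simp [hβ0.le]
    have hge : h - 2 * d - 2 ≤ diagShift Vhi β ω ℰ x := by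
      rw [diagShift, hV x hx]
      linarith [hℰ.2]
    calc 2 * (d : ℝ) = q * (h - 2 * d - 2) := by rw [hq, div_mul_cancel₀ _ hden.ne']
      _ ≤ q * diagShift Vhi β ω ℰ x := by gcongr
  have hmn : boxF (0 : Site d) (R + a ^ (i + 1) * (2 * R) : ℕ) ⊆
      boxF (0 : Site d) (R + a ^ (i + 1 + 1) * (2 * R) : ℕ) := fun x hx => by
    refine mem_boxF_zero_iff.2 ((mem_boxF_zero_iff.1 hx).trans ?_)
    gcongr <;> omega
  have hL : (R : ℝ) ≤ (a : ℝ) ^ i * (2 * R) := by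
    have h1 : (1 : ℝ) ≤ (a : ℝ) ^ i := one_le_pow₀ (by linarith)
    nlinarith [(Nat.cast_nonneg R : (0 : ℝ) ≤ R)]
  have hbound : 2 * (d : ℝ) * q ^ (2 * (a ^ (i + 1) * (2 * R))) ≤
      (1 / (4 * (d : ℝ) + h + β)) ^ ((2 * (a : ℝ) - 0.3) * ((a : ℝ) ^ i * (2 * R))) := by
    refine two_mul_pow_le_rpow hq0 (by linarith : 0 < 4 * (d : ℝ) + h + 1) ?_
      (by positivity) (by linarith) hhbig (by push_cast; ring) (le_trans ?_ hsmall.le)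
    · rw [one_div]
      exact inv_anti₀ (by linarith) (by linarith)
    · exact mul_le_mul_of_nonneg_left
        (Real.rpow_le_rpow_of_exponent_ge hq0 hq1.le (by linarith)) (by positivity)
  refine (l2norm_mulVec_le_of_forall_abs_le ?_ (by positivity)
    (fun e he b => abs_schurC_sub_mulVec_le hd (fun _ => mem_boxF_zero_iff)
      (fun _ => mem_boxF_zero_iff) hmn hq0 hq1 hD he b) v).trans
    (mul_le_mul_of_nonneg_right hbound (Real.sqrt_nonneg _))
  rw [Matrix.transpose_sub, schurC_transpose, schurC_transpose]

end HierABM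
end
end

section
/- (Spectral inclusion for the hierarchical Anderson–Bernoulli model.) Let V_hi : ℤ^d → {0,h} with h > 4d+1, let 0 < β ≤ 1, and let H(ω) = 2d − Δ + V_hi + βω on ℓ²(ℤ^d). Then for every configuration ω ∈ {0,1}^{ℤ^d}: Spec(H(ω)) ⊂ [0, 4d+β] ∪ [h, h+4d+β]. -/
noncomputable section

open scoped ENNReal

namespace HierABM

variable {d : ℕ}

/-- Real `ℓ²(ℤ^d)`. -/
abbrev L2 (d : ℕ) := lp (fun _ : Site d => ℝ) 2

/-- Pointwise multiplication by a function bounded by `1`, as a bounded operator on `ℓ²(ℤ^d)`. -/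
def mulOp (s : Site d → ℝ) (hs : ∀ x, |s x| ≤ 1) : L2 d →L[ℝ] L2 d :=
  LinearMap.mkContinuous
    { toFun := fun f => ⟨fun x => s x * f x, (lp.memℓp f).mono' fun x => by
        rw [norm_mul]
        exact mul_le_of_le_one_left (norm_nonneg _) (hs x)⟩
      map_add' := fun f g => by
        ext x
        exact mul_add _ _ _
      map_smul' := fun c f => by
        ext x
        exact mul_left_comm _ _ _ } 1 fun f => by
    rw [one_mul]
    refine lp.norm_mono two_ne_zero fun x => ?_
    change ‖s x * f x‖ ≤ ‖f x‖
    rw [norm_mul]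
    exact mul_le_of_le_one_left (norm_nonneg _) (hs x)

theorem mulOp_apply (s : Site d → ℝ) (hs : ∀ x, |s x| ≤ 1) (f : L2 d) (x : Site d) :
    mulOp s hs f x = s x * f x := rfl

theorem hasSum_sq (f : L2 d) : HasSum (fun x => f x ^ 2) (‖f‖ ^ 2) := by
  have := lp.hasSum_inner (𝕜 := ℝ) f f
  simpa [real_inner_self_eq_norm_sq] using this

/-- The quadratic bound dominating `f x * discLap f x` sums to `2d ‖f‖²`. -/
theorem hasSum_neighbour_sq (f : L2 d) :
    HasSum (fun x => ∑ i : Fin d, (f x ^ 2 + (f (x + unit i) ^ 2 + f (x - unit i) ^ 2) / 2))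
      (2 * d * ‖f‖ ^ 2) := by
  have h0 := hasSum_sq f
  have h := hasSum_sum (s := Finset.univ) fun (i : Fin d) _ =>
    h0.add ((((Equiv.addRight (unit i)).hasSum_iff.2 h0).add
      ((Equiv.subRight (unit i)).hasSum_iff.2 h0)).div_const 2)
  convert h using 1
  · rfl
  simp only [Finset.sum_const, Finset.card_univ, Fintype.card_fin, nsmul_eq_mul]
  ring

theorem abs_mul_discLap_le (f : Site d → ℝ) (x : Site d) :
    |f x * discLap f x| ≤
      ∑ i : Fin d, (f x ^ 2 + (f (x + unit i) ^ 2 + f (x - unit i) ^ 2) / 2) := by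
  rw [discLap, Finset.mul_sum]
  refine (Finset.abs_sum_le_sum_abs _ _).trans (Finset.sum_le_sum fun i _ => abs_le.2 ⟨?_, ?_⟩)
  · nlinarith [sq_nonneg (f x + f (x + unit i)), sq_nonneg (f x + f (x - unit i))]
  · nlinarith [sq_nonneg (f x - f (x + unit i)), sq_nonneg (f x - f (x - unit i))]

/-- A diagonal operator minus the discrete Laplacian is invertible when the diagonal is
bounded away from `[-2d, 2d]`. -/
theorem isUnit_of_diagonal_sub_discLap (A : L2 d →L[ℝ] L2 d) (D : Site d → ℝ) {c : ℝ} (hc : 0 < c)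
    (hD : ∀ x, 2 * d + c ≤ |D x|)
    (hA : ∀ (f : L2 d) (x : Site d), A f x = D x * f x - discLap f x) : IsUnit A := by
  have hD0 : ∀ x, D x ≠ 0 := fun x => by
    have : (0 : ℝ) ≤ d := d.cast_nonneg
    exact abs_pos.1 (by linarith [hD x])
  let s : Site d → ℝ := fun x => SignType.sign (D x)
  have hs1 : ∀ x, |s x| = 1 := fun x => by
    rcases (hD0 x).lt_or_gt with hx | hx <;> simp [s, hx]
  let J := mulOp s fun x => (hs1 x).le
  have hJJ : J * J = 1 := by
    ext f x
    change s x * (s x * f x) = f x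
    rw [← mul_assoc, ← abs_mul_abs_self, hs1, one_mul, one_mul]
  have hJA : IsUnit (J * A) := by
    refine ContinuousLinearMap.isUnit_of_forall_le_norm_inner_map (𝕜 := ℝ) _
      (c := ⟨c, hc.le⟩) hc fun f => le_trans ?_ (le_abs_self _)
    have hl := ((hasSum_sq f).mul_left (2 * d + c)).sub (hasSum_neighbour_sq f)
    have hle := hasSum_le (fun x => ?_) hl (lp.hasSum_inner (𝕜 := ℝ) ((J * A) f) f)
    · change ‖f‖ ^ 2 * c ≤ _
      linarith
    · change _ ≤ f x * (s x * A f x)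
      have hsD : s x * D x = |D x| := sign_mul_self (D x)
      have hlap : s x * (f x * discLap f x) ≤ |f x * discLap f x| :=
        (le_abs_self _).trans_eq (by rw [abs_mul, hs1, one_mul])
      have hsq := mul_le_mul_of_nonneg_right (hD x) (sq_nonneg (f x))
      have heq : f x * (s x * A f x) = |D x| * f x ^ 2 - s x * (f x * discLap f x) := by
        rw [hA, ← hsD]
        ring
      rw [heq]
      linarith [abs_mul_discLap_le f x]
  have hJ : IsUnit J := ⟨⟨J, J, hJJ, hJJ⟩, rfl⟩
  have : A = J * (J * A) := by rw [← mul_assoc, hJJ, one_mul]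
  rw [this]
  exact hJ.mul hJA

/-- **Spectral inclusion for the hierarchical Anderson–Bernoulli model** (eq. (1.11)):
for every configuration `ω`, `Spec H(ω) ⊆ [0, 4d+β] ∪ [h, h+4d+β]`, where
`H(ω) = 2d - Δ + V_hi + βω` is pinned down by its pointwise action `hHop`. -/
theorem spectral_inclusion
    (d : ℕ) (hd : 1 ≤ d)
    (h β : ℝ) (hh : 4 * (d : ℝ) + 1 < h) (hβ0 : 0 < β) (hβ1 : β ≤ 1)
    (Vhi : Site d → ℝ) (hV : ∀ x, Vhi x = 0 ∨ Vhi x = h)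
    (Hop : (Site d → Bool) → L2 d →L[ℝ] L2 d)
    (hHop : ∀ ω (f : L2 d) (x : Site d), (Hop ω f) x = hamAct Vhi β ω (⇑f) x)
    (ω : Site d → Bool) :
    spectrum ℝ (Hop ω) ⊆
      Set.Icc 0 (4 * (d : ℝ) + β) ∪ Set.Icc h (h + 4 * (d : ℝ) + β) := by
  intro μ hμ
  by_contra hout
  simp only [Set.mem_union, Set.mem_Icc, not_or, not_and, not_le] at hout
  obtain ⟨hout0, houth⟩ := hout
  have hd0 : (0 : ℝ) ≤ d := d.cast_nonneg
  obtain ⟨c, hc, hgap⟩ : ∃ c : ℝ, 0 < c ∧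
      ((μ ≤ -c) ∨ (4 * d + β + c ≤ μ ∧ μ + c ≤ h) ∨ h + 4 * d + β + c ≤ μ) := by
    rcases lt_or_ge μ 0 with h0 | h0
    · exact ⟨-μ, by linarith, Or.inl (by linarith)⟩
    rcases lt_or_ge μ h with h1 | h1
    · have h2 := hout0 h0
      refine ⟨min (μ - (4 * d + β)) (h - μ), lt_min (by linarith) (by linarith),
        Or.inr (Or.inl ⟨?_, ?_⟩)⟩
      · linarith [min_le_left (μ - (4 * d + β)) (h - μ)]
      · linarith [min_le_right (μ - (4 * d + β)) (h - μ)]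
    · have h2 := houth h1
      exact ⟨μ - (h + 4 * d + β), by linarith, Or.inr (Or.inr (by linarith))⟩
  have hunit : IsUnit (Hop ω - algebraMap ℝ (L2 d →L[ℝ] L2 d) μ) := by
    refine isUnit_of_diagonal_sub_discLap _
      (fun x => 2 * d + Vhi x + β * (if ω x then 1 else 0) - μ) hc (fun x => ?_) fun f x => ?_
    · have hω : 0 ≤ β * (if ω x then (1 : ℝ) else 0) ∧ β * (if ω x then (1 : ℝ) else 0) ≤ β := by
        split_ifs <;> constructor <;> linarith
      obtain ⟨hω0, hω1⟩ := hω
      rw [le_abs]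
      rcases hV x with hx | hx <;> rw [hx] <;> rcases hgap with hg | ⟨hg, hg'⟩ | hg <;>
        first
        | (left; linarith)
        | (right; linarith)
    · change Hop ω f x - μ * f x = _
      rw [hHop, hamAct]
      ring
  refine spectrum.mem_iff.1 hμ ?_
  rw [← neg_sub]
  exact hunit.neg

end HierABM
end
end
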